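/- Let K = ℚ(√D) with D ≥ 2 squarefree, Δ its discriminant, and m ≥ 1 an integer. If α ∈ O_K is totally positive and can be represented as an unordered sum of indecomposable totally positive elements in at most m ways, then Nm(α) < m²(2m+1)(2m+3)·√Δ(√Δ+2)². -/

import Mathlib

noncomputable section

/-- `ω_D`: the standard generator of the ring of integers of `ℚ(√D)`. -/
def omegaD (D : ℕ) : ℝ := if D % 4 = 1 then (1 + Real.sqrt D) / 2 else Real.sqrt D

/-- The Galois conjugate of `ω_D`. -/
def omegaD' (D : ℕ) : ℝ := if D % 4 = 1 then (1 - Real.sqrt D) / 2 else -Real.sqrt D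

/-- Elements of `O_K` in coordinates: `(x, y)` represents `x + y·ω_D`. -/
abbrev OK : Type := ℤ × ℤ

/-- First real embedding. -/
def emb1 (D : ℕ) (a : OK) : ℝ := a.1 + a.2 * omegaD D

/-- Second real embedding (Galois conjugate). -/
def emb2 (D : ℕ) (a : OK) : ℝ := a.1 + a.2 * omegaD' D

/-- Galois conjugation on `O_K`. -/
def conjOK (D : ℕ) (a : OK) : OK := (a.1 + (if D % 4 = 1 then (1 : ℤ) else 0) * a.2, -a.2)

/-- Total positivity. -/
def TotPos (D : ℕ) (a : OK) : Prop := 0 < emb1 D a ∧ 0 < emb2 D a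

/-- The field norm. -/
def Nm (D : ℕ) (a : OK) : ℝ := emb1 D a * emb2 D a

/-- Indecomposability: totally positive and not a sum of two totally positive elements. -/
def Indec (D : ℕ) (a : OK) : Prop :=
  TotPos D a ∧ ¬ ∃ b c : OK, TotPos D b ∧ TotPos D c ∧ a = b + c

/-- Number of partitions of `α` into indecomposable parts (`p_K(α|I)`). -/
def pKI (D : ℕ) (α : OK) : ℕ :=
  Set.ncard {s : Multiset OK | (∀ x ∈ s, Indec D x) ∧ s.sum = α}

/-- Number of partitions of `α` into totally positive parts (`p_K(α)`). -/
def pK (D : ℕ) (α : OK) : ℕ :=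
  Set.ncard {s : Multiset OK | (∀ x ∈ s, TotPos D x) ∧ s.sum = α}

/-- Discriminant of `ℚ(√D)`. -/
def disc (D : ℕ) : ℕ := if D % 4 = 1 then D else 4 * D

/-- The ordered two-sided sequence of indecomposables together with
the coefficients `v j ≥ 2` from the Hejda–Kala relation `v_j β_j = β_{j-1} + β_{j+1}`. -/
structure BetaSeq (D : ℕ) (β : ℤ → OK) (v : ℤ → ℤ) : Prop where
  indec : ∀ j, Indec D (β j)
  surj : ∀ a : OK, Indec D a → ∃ j, β j = a
  mono : StrictMono fun j => emb1 D (β j)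
  zero : β 0 = (1, 0)
  conj_eq : ∀ j, β (-j) = conjOK D (β j)
  v_two_le : ∀ j, 2 ≤ v j
  v_symm : ∀ j, v (-j) = v j
  rel : ∀ j, v j • β j = β (j - 1) + β (j + 1)

/-- The continued fraction data of `ω_D = [⌈u₀/2⌉, \overline{u₁, …, u_s}]` (with `u_s = u_0`),
with tails `γ_0 = ω_D`, `γ_i = [u_i, u_{i+1}, …]` for `i ≥ 1`. -/
structure CFData (D : ℕ) (u : ℕ → ℕ) (γ : ℕ → ℝ) : Prop where
  gamma_zero : γ 0 = omegaD D
  u_zero : (u 0 : ℤ) = 2 * ⌊omegaD D⌋ - (if D % 4 = 1 then 1 else 0)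
  head : omegaD D = (⌊omegaD D⌋ : ℝ) + 1 / γ 1
  step : ∀ i, 1 ≤ i → γ i = u i + 1 / γ (i + 1)
  one_lt : ∀ i, 1 ≤ i → 1 < γ i
  floor_eq : ∀ i, 1 ≤ i → (u i : ℤ) = ⌊γ i⌋
  period : ∃ s, 1 ≤ s ∧ u s = u 0 ∧ ∀ i, 1 ≤ i → u (i + s) = u i

/-- The convergents `α_i = p_i + q_i ξ_D`, indexed by `i ≥ -1`. -/
structure ConvData (D : ℕ) (u : ℕ → ℕ) (a : ℤ → OK) : Prop where
  neg_one : a (-1) = (1, 0)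
  zero : a 0 = (⌊omegaD D⌋, 0) + (if D % 4 = 1 then ((-1 : ℤ), (1 : ℤ)) else (0, 1))
  recur : ∀ i : ℤ, -1 ≤ i → a (i + 2) = (u (i + 2).toNat : ℤ) • a (i + 1) + a i

/-- Semiconvergents `α_{i,r} = α_i + r·α_{i+1}`. -/
def semiconv (a : ℤ → OK) (i r : ℤ) : OK := a i + r • a (i + 1)

/-! ### Helper lemmas -/

lemma emb1_add (D : ℕ) (a b : OK) : emb1 D (a + b) = emb1 D a + emb1 D b := by
  simp only [emb1, Prod.fst_add, Prod.snd_add]; push_cast; ring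

lemma emb2_add (D : ℕ) (a b : OK) : emb2 D (a + b) = emb2 D a + emb2 D b := by
  simp only [emb2, Prod.fst_add, Prod.snd_add]; push_cast; ring

lemma emb1_sub (D : ℕ) (a b : OK) : emb1 D (a - b) = emb1 D a - emb1 D b := by
  simp only [emb1, Prod.fst_sub, Prod.snd_sub]; push_cast; ring

lemma emb2_sub (D : ℕ) (a b : OK) : emb2 D (a - b) = emb2 D a - emb2 D b := by
  simp only [emb2, Prod.fst_sub, Prod.snd_sub]; push_cast; ring

lemma emb1_zsmul (D : ℕ) (n : ℤ) (b : OK) : emb1 D (n • b) = n * emb1 D b := by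
  simp only [emb1, Prod.smul_fst, Prod.smul_snd, smul_eq_mul]; push_cast; ring

lemma emb2_zsmul (D : ℕ) (n : ℤ) (b : OK) : emb2 D (n • b) = n * emb2 D b := by
  simp only [emb2, Prod.smul_fst, Prod.smul_snd, smul_eq_mul]; push_cast; ring

lemma emb1_nsmul (D : ℕ) (n : ℕ) (b : OK) : emb1 D (n • b) = n * emb1 D b := by
  have := emb1_zsmul D n b
  simpa using this

lemma emb2_nsmul (D : ℕ) (n : ℕ) (b : OK) : emb2 D (n • b) = n * emb2 D b := by
  have := emb2_zsmul D n b
  simpa using this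

lemma omega_sub (D : ℕ) : omegaD D - omegaD' D = Real.sqrt (disc D) := by
  unfold omegaD omegaD' disc
  split_ifs
  · ring
  · push_cast
    rw [Real.sqrt_mul (by norm_num), show (4 : ℝ) = 2 ^ 2 by norm_num,
      Real.sqrt_sq (by norm_num)]
    ring

lemma two_le_s (D : ℕ) (hD : 2 ≤ D) : 2 ≤ Real.sqrt (disc D) := by
  apply Real.le_sqrt_of_sq_le
  have : 4 ≤ disc D := by
    unfold disc
    split_ifs <;> omega
  have : (4 : ℝ) ≤ disc D := by exact_mod_cast this
  linarith

lemma irr (D : ℕ) (hD : 2 ≤ D) (hsq : Squarefree D) : Irrational (Real.sqrt D) := by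
  rw [irrational_sqrt_natCast_iff]
  rintro ⟨n, rfl⟩
  have := hsq n dvd_rfl
  rw [Nat.isUnit_iff] at this
  subst this
  omega

lemma irr' (D : ℕ) (hD : 2 ≤ D) (hsq : Squarefree D) : Irrational (omegaD' D) := by
  have h := irr D hD hsq
  unfold omegaD'
  split_ifs
  · have := (h.natCast_sub 1).div_natCast (m := 2) (by norm_num)
    simpa using this
  · exact h.neg

lemma emb2_eq_zero (D : ℕ) (hD : 2 ≤ D) (hsq : Squarefree D) (a : OK) (h : emb2 D a = 0) :
    a = 0 := by
  have hi := irr' D hD hsq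
  unfold emb2 at h
  by_cases h2 : a.2 = 0
  · rw [h2] at h
    simp at h
    exact Prod.ext h h2
  · exfalso
    have := (hi.intCast_mul h2).intCast_add a.1
    rw [h] at this
    exact this ⟨0, by simp⟩

lemma trace_int (D : ℕ) (a : OK) : ∃ z : ℤ, emb1 D a + emb2 D a = z := by
  unfold emb1 emb2 omegaD omegaD'
  split_ifs
  · exact ⟨2 * a.1 + a.2, by push_cast; ring⟩
  · exact ⟨2 * a.1, by push_cast; ring⟩

lemma norm_int (D : ℕ) (a : OK) : ∃ z : ℤ, Nm D a = z := by
  have hs : Real.sqrt D * Real.sqrt D = D := Real.mul_self_sqrt (Nat.cast_nonneg D)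
  unfold Nm emb1 emb2 omegaD omegaD'
  split_ifs with h
  · refine ⟨a.1 ^ 2 + a.1 * a.2 - a.2 ^ 2 * (D / 4 : ℕ), ?_⟩
    have hd : (D : ℝ) = 4 * (D / 4 : ℕ) + 1 := by
      have : D = 4 * (D / 4) + 1 := by omega
      exact_mod_cast this
    have : ((D / 4 : ℕ) : ℝ) = (Real.sqrt D * Real.sqrt D - 1) / 4 := by rw [hs]; linarith
    simp only [Int.cast_sub, Int.cast_add, Int.cast_mul, Int.cast_pow, Int.cast_natCast]
    rw [this]
    ring
  · refine ⟨a.1 ^ 2 - a.2 ^ 2 * D, ?_⟩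
    push_cast
    linear_combination (-(a.2 : ℝ) ^ 2) * hs

lemma one_le_of_int {x : ℝ} (h : ∃ z : ℤ, x = z) (hx : 0 < x) : 1 ≤ x := by
  obtain ⟨z, rfl⟩ := h
  have : 0 < z := by exact_mod_cast hx
  exact_mod_cast this

lemma TotPos.add {D : ℕ} {a b : OK} (ha : TotPos D a) (hb : TotPos D b) : TotPos D (a + b) := by
  refine ⟨?_, ?_⟩
  · rw [emb1_add]; exact add_pos ha.1 hb.1
  · rw [emb2_add]; exact add_pos ha.2 hb.2

lemma det_id (D : ℕ) (u w : OK) : emb1 D w * emb2 D u - emb2 D w * emb1 D u =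
    ((u.1 * w.2 - u.2 * w.1 : ℤ) : ℝ) * Real.sqrt (disc D) := by
  rw [← omega_sub]
  unfold emb1 emb2
  push_cast
  ring

lemma finite_box (D : ℕ) (hD : 2 ≤ D) (C : ℝ) :
    {a : OK | TotPos D a ∧ emb1 D a ≤ C ∧ emb2 D a ≤ C}.Finite := by
  have hs := two_le_s D hD
  obtain ⟨N, hN⟩ := exists_nat_ge (C + C * |omegaD D|)
  obtain ⟨M, hM⟩ := exists_nat_ge C
  apply Set.Finite.subset (Set.Finite.prod (Set.finite_Icc (-N : ℤ) N) (Set.finite_Icc (-M : ℤ) M))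
  rintro a ⟨⟨h1, h2⟩, h3, h4⟩
  have hC : 0 < C := by linarith
  have key : (a.2 : ℝ) * Real.sqrt (disc D) = emb1 D a - emb2 D a := by
    rw [← omega_sub]; unfold emb1 emb2; ring
  have hle : |(a.2 : ℝ)| ≤ C := by
    rw [abs_le]
    constructor <;> by_contra! hh <;> nlinarith
  have hle1 : |(a.1 : ℝ)| ≤ N := by
    have e : (a.1 : ℝ) = emb1 D a - a.2 * omegaD D := by unfold emb1; ring
    have h5 : |(a.2 : ℝ) * omegaD D| ≤ C * |omegaD D| := by
      rw [abs_mul]; exact mul_le_mul_of_nonneg_right hle (abs_nonneg _)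
    have h6 := abs_le.mp h5
    rw [abs_le]
    constructor <;> rw [e] <;> linarith [h6.1, h6.2]
  have hle2 : |(a.2 : ℝ)| ≤ M := hle.trans hM
  rw [abs_le] at hle1 hle2
  refine Set.mem_prod.2 ⟨⟨?_, ?_⟩, ⟨?_, ?_⟩⟩
  · exact_mod_cast hle1.1
  · exact_mod_cast hle1.2
  · exact_mod_cast hle2.1
  · exact_mod_cast hle2.2

lemma sum_totPos (D : ℕ) (s : Multiset OK) (hs : ∀ x ∈ s, TotPos D x) :
    s = 0 ∨ TotPos D s.sum := by
  induction s using Multiset.induction_on with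
  | empty => left; rfl
  | cons a s ih =>
    right
    rw [Multiset.sum_cons]
    have ha := hs a (Multiset.mem_cons_self a s)
    rcases ih (fun x hx => hs x (Multiset.mem_cons_of_mem hx)) with h | h
    · subst h; simpa using ha
    · exact ha.add h

lemma card_le_trace (D : ℕ) (s : Multiset OK) (hs : ∀ x ∈ s, TotPos D x) :
    (s.card : ℝ) ≤ emb1 D s.sum + emb2 D s.sum := by
  induction s using Multiset.induction_on with
  | empty => simp [emb1, emb2]
  | cons a s ih =>
    rw [Multiset.sum_cons, emb1_add, emb2_add, Multiset.card_cons]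
    have ha := hs a (Multiset.mem_cons_self a s)
    have h1 := one_le_of_int (trace_int D a) (add_pos ha.1 ha.2)
    have h2 := ih (fun x hx => hs x (Multiset.mem_cons_of_mem hx))
    push_cast
    linarith

lemma finite_parts (D : ℕ) (hD : 2 ≤ D) (α : OK) :
    {s : Multiset OK | (∀ x ∈ s, Indec D x) ∧ s.sum = α}.Finite := by
  classical
  have hF := finite_box D hD (max (emb1 D α) (emb2 D α))
  obtain ⟨N, hN⟩ := exists_nat_ge (emb1 D α + emb2 D α)
  apply (Set.finite_Icc (0 : Multiset OK) (N • hF.toFinset.val)).subset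
  rintro s ⟨hs, hsum⟩
  refine ⟨Multiset.zero_le _, ?_⟩
  have hs' : ∀ x ∈ s, TotPos D x := fun x hx => (hs x hx).1
  rw [Multiset.le_iff_count]
  intro x
  by_cases hx : x ∈ s
  · have hxF : x ∈ hF.toFinset := by
      rw [Set.Finite.mem_toFinset]
      refine ⟨hs' x hx, ?_⟩
      obtain ⟨t, rfl⟩ := Multiset.exists_cons_of_mem hx
      rw [Multiset.sum_cons] at hsum
      have ht := sum_totPos D t (fun y hy => hs' y (Multiset.mem_cons_of_mem hy))
      rcases ht with h | h
      · subst h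
        simp at hsum
        subst hsum
        exact ⟨le_max_left _ _, le_max_right _ _⟩
      · rw [← hsum, emb1_add, emb2_add]
        exact ⟨le_max_of_le_left (by linarith [h.1]), le_max_of_le_right (by linarith [h.2])⟩
    rw [Multiset.count_nsmul, Multiset.count_eq_one_of_mem hF.toFinset.nodup hxF, mul_one]
    have h1 := card_le_trace D s hs'
    rw [hsum] at h1
    have h2 : s.card ≤ N := by exact_mod_cast h1.trans hN
    exact (Multiset.count_le_card x s).trans h2
  · rw [Multiset.count_eq_zero_of_notMem hx]; exact Nat.zero_le _

lemma exists_part (D : ℕ) (α : OK) (hα : TotPos D α) :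
    ∃ s : Multiset OK, (∀ x ∈ s, Indec D x) ∧ s.sum = α := by
  obtain ⟨n, hn⟩ := exists_nat_ge (emb1 D α + emb2 D α)
  induction n generalizing α with
  | zero =>
    have := hα.1; have := hα.2
    push_cast at hn
    linarith
  | succ n ih =>
    by_cases hi : Indec D α
    · exact ⟨{α}, by simpa using hi, by simp⟩
    · have : ∃ b c : OK, TotPos D b ∧ TotPos D c ∧ α = b + c := by
        by_contra hh
        exact hi ⟨hα, hh⟩
      obtain ⟨b, c, hb, hc, rfl⟩ := this
      have h1 := one_le_of_int (trace_int D b) (add_pos hb.1 hb.2)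
      have h2 := one_le_of_int (trace_int D c) (add_pos hc.1 hc.2)
      rw [emb1_add, emb2_add] at hn
      push_cast at hn
      obtain ⟨s, hs, hs'⟩ := ih b hb (by linarith)
      obtain ⟨t, ht, ht'⟩ := ih c hc (by linarith)
      refine ⟨s + t, ?_, by rw [Multiset.sum_add, hs', ht']⟩
      intro x hx
      rcases Multiset.mem_add.1 hx with h | h
      · exact hs x h
      · exact ht x h

lemma exists_part_avoid (D : ℕ) (β γ : OK) (hγ : TotPos D γ) (h1 : ¬ TotPos D (γ - β))
    (h2 : γ ≠ β) :
    ∃ s : Multiset OK, (∀ x ∈ s, Indec D x) ∧ s.sum = γ ∧ β ∉ s := by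
  obtain ⟨s, hs, hsum⟩ := exists_part D γ hγ
  refine ⟨s, hs, hsum, fun hβ => ?_⟩
  obtain ⟨t, rfl⟩ := Multiset.exists_cons_of_mem hβ
  rw [Multiset.sum_cons] at hsum
  rcases sum_totPos D t (fun y hy => (hs y (Multiset.mem_cons_of_mem hy)).1) with h | h
  · subst h; simp at hsum; exact h2 hsum.symm
  · apply h1
    rw [← hsum]
    simpa using h

/-- Many copies of `β` give many partitions. -/
lemma many_parts (D : ℕ) (hD : 2 ≤ D) (m a b v : ℕ) (α β γ δ : OK) (hβ : Indec D β)
    (hγ : TotPos D γ) (hδ : TotPos D δ)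
    (hγ1 : ¬ TotPos D (γ - β)) (hγ2 : γ ≠ β) (hδ1 : ¬ TotPos D (δ - β)) (hδ2 : δ ≠ β)
    (hv : 1 ≤ v) (hrel : v • β = γ + δ) (hα : α = a • β + b • γ) (h : pKI D α ≤ m) :
    a < m * v := by
  classical
  by_contra! hav
  obtain ⟨P, hP, hPs, hPβ⟩ := exists_part_avoid D β γ hγ hγ1 hγ2
  obtain ⟨Q, hQ, hQs, hQβ⟩ := exists_part_avoid D β δ hδ hδ1 hδ2
  let f : ℕ → Multiset OK := fun k => Multiset.replicate (a - k * v) β + (b + k) • P + k • Q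
  have hcount : ∀ k, (f k).count β = a - k * v := by
    intro k
    simp only [f, Multiset.count_add, Multiset.count_nsmul, Multiset.count_replicate_self,
      Multiset.count_eq_zero_of_notMem hPβ, Multiset.count_eq_zero_of_notMem hQβ]
    simp
  have hkv : ∀ k, k ≤ m → k * v ≤ a := fun k hk => (Nat.mul_le_mul_right v hk).trans hav
  have hinj : Set.InjOn f (Finset.range (m + 1) : Set ℕ) := by
    intro k hk l hl hkl
    simp only [Finset.coe_range, Set.mem_Iio] at hk hl
    have h1 := hcount k
    rw [hkl, hcount l] at h1
    have h2 := hkv k (by omega)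
    have h3 := hkv l (by omega)
    have h4 : k * v = l * v := by omega
    exact Nat.eq_of_mul_eq_mul_right (by omega) h4
  have hsub : f '' (Finset.range (m + 1) : Set ℕ) ⊆
      {s : Multiset OK | (∀ x ∈ s, Indec D x) ∧ s.sum = α} := by
    rintro _ ⟨k, hk, rfl⟩
    simp only [Finset.coe_range, Set.mem_Iio] at hk
    refine ⟨?_, ?_⟩
    · intro x hx
      simp only [f, Multiset.mem_add] at hx
      rcases hx with (hx | hx) | hx
      · rw [Multiset.eq_of_mem_replicate hx]; exact hβ
      · exact hP x (Multiset.mem_of_mem_nsmul hx)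
      · exact hQ x (Multiset.mem_of_mem_nsmul hx)
    · simp only [f, Multiset.sum_add, Multiset.sum_nsmul, Multiset.sum_replicate, hPs, hQs]
      obtain ⟨c, hc⟩ := Nat.exists_eq_add_of_le (hkv k (by omega))
      rw [hα, hc, Nat.add_sub_cancel_left, add_smul (k * v), mul_smul, hrel, smul_add, add_smul]
      abel
  have h1 := Set.ncard_le_ncard hsub (finite_parts D hD α)
  rw [hinj.ncard_image, Set.ncard_coe_finset, Finset.card_range] at h1
  unfold pKI at h
  omega

/-- Adjacent totally positive elements are indecomposable. -/
lemma adj_indec (D : ℕ) (hD : 2 ≤ D) (β γ : OK) (hβ : TotPos D β) (hγ : TotPos D γ)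
    (hdet : β.1 * γ.2 - β.2 * γ.1 = 1) (h1 : emb1 D β < emb1 D γ) (h2 : emb2 D γ < emb2 D β) :
    Indec D γ := by
  refine ⟨hγ, ?_⟩
  have hs := two_le_s D hD
  -- no totally positive element has nonpositive coordinate for `γ` and complement totally positive
  have key : ∀ b c : OK, TotPos D b → TotPos D c → γ = b + c →
      β.1 * b.2 - β.2 * b.1 ≤ 0 → False := by
    intro b c hb hc hbc hj
    set j : ℤ := β.1 * b.2 - β.2 * b.1 with hjd
    set i : ℤ := b.1 * γ.2 - b.2 * γ.1 with hid
    have hb' : b = i • β + j • γ := by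
      ext
      · simp only [Prod.fst_add, Prod.smul_fst, smul_eq_mul, hjd, hid]
        linear_combination (-b.1) * hdet
      · simp only [Prod.snd_add, Prod.smul_snd, smul_eq_mul, hjd, hid]
        linear_combination (-b.2) * hdet
    have hc' : c = γ - b := by rw [hbc]; simp
    have hb1 := hb.1
    have hc2 := hc.2
    rw [hb', emb1_add, emb1_zsmul, emb1_zsmul] at hb1
    rw [hc', hb', emb2_sub, emb2_add, emb2_zsmul, emb2_zsmul] at hc2
    have p1 := hβ.1
    have p2 := hβ.2
    have q1 := hγ.1
    have q2 := hγ.2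
    have hjr : (j : ℝ) ≤ 0 := by exact_mod_cast hj
    -- `i > -j`
    have A : (0 : ℝ) < i + j := by
      by_contra! hh
      nlinarith
    have B : (i : ℝ) + j < 1 := by
      by_contra! hh
      nlinarith
    have A' : 0 < i + j := by exact_mod_cast A
    have B' : i + j < 1 := by exact_mod_cast B
    omega
  rintro ⟨b, c, hb, hc, hbc⟩
  by_cases hj : β.1 * b.2 - β.2 * b.1 ≤ 0
  · exact key b c hb hc hbc hj
  · refine key c b hc hb (by rw [hbc, add_comm]) ?_
    have e : (β.1 * b.2 - β.2 * b.1) + (β.1 * c.2 - β.2 * c.1) = 1 := by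
      rw [← hdet, hbc]
      simp only [Prod.fst_add, Prod.snd_add]
      ring
    omega

/-- The right neighbour of an indecomposable element. -/
lemma exists_neighbour (D : ℕ) (hD : 2 ≤ D) (hsq : Squarefree D) (β : OK) (hβ : Indec D β) :
    ∃ γ : OK, TotPos D γ ∧ β.1 * γ.2 - β.2 * γ.1 = 1 ∧ emb1 D β < emb1 D γ ∧
      emb2 D γ < emb2 D β := by
  have hs := two_le_s D hD
  obtain ⟨⟨p1, p2⟩, hind⟩ := hβ
  have hcop : Int.gcd β.1 β.2 = 1 := by
    by_contra hg
    set g := Int.gcd β.1 β.2 with hgd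
    obtain ⟨x, hx⟩ : (g : ℤ) ∣ β.1 := Int.gcd_dvd_left ..
    obtain ⟨y, hy⟩ : (g : ℤ) ∣ β.2 := Int.gcd_dvd_right ..
    have hb : β = g • ((x, y) : OK) := by
      ext
      · simp [hx]
      · simp [hy]
    rw [hb] at p1 p2
    rw [emb1_nsmul] at p1
    rw [emb2_nsmul] at p2
    have hg0 : 0 < g := by
      rcases Nat.eq_zero_or_pos g with h | h
      · rw [h] at p1; simp at p1
      · exact h
    obtain ⟨k, hk⟩ : ∃ k, g = 1 + (k + 1) := ⟨g - 2, by omega⟩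
    have q1 : 0 < emb1 D (x, y) := pos_of_mul_pos_right p1 (by positivity)
    have q2 : 0 < emb2 D (x, y) := pos_of_mul_pos_right p2 (by positivity)
    refine hind ⟨(x, y), (k + 1) • ((x, y) : OK), ⟨q1, q2⟩, ⟨?_, ?_⟩, ?_⟩
    · rw [emb1_nsmul]; positivity
    · rw [emb2_nsmul]; positivity
    · rw [hb, hk, add_smul, one_smul]
  have hbez := Int.gcd_eq_gcd_ab β.1 β.2
  rw [hcop] at hbez
  push_cast at hbez
  let γ0 : OK := (-(Int.gcdB β.1 β.2), Int.gcdA β.1 β.2)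
  let k : ℤ := ⌊emb2 D γ0 / emb2 D β⌋
  let γ : OK := γ0 - k • β
  have hdet : β.1 * γ.2 - β.2 * γ.1 = 1 := by
    simp only [γ, γ0, Prod.fst_sub, Prod.snd_sub, Prod.smul_fst, Prod.smul_snd, smul_eq_mul]
    linear_combination -hbez
  have hid := det_id D β γ
  rw [hdet] at hid
  push_cast at hid
  have e2 : emb2 D γ = emb2 D γ0 - k * emb2 D β := by rw [emb2_sub, emb2_zsmul]
  have hk1 : (k : ℝ) * emb2 D β ≤ emb2 D γ0 := by
    rw [← le_div_iff₀ p2]; exact Int.floor_le _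
  have hk2 : emb2 D γ0 < (k + 1) * emb2 D β := by
    rw [← div_lt_iff₀ p2]; exact Int.lt_floor_add_one _
  have hγne : emb2 D γ ≠ 0 := by
    intro h0
    have := emb2_eq_zero D hD hsq γ h0
    rw [this] at hdet
    simp at hdet
  have g2 : 0 < emb2 D γ := lt_of_le_of_ne (by linarith) (Ne.symm hγne)
  have g2' : emb2 D γ < emb2 D β := by linarith
  have g1 : 0 < emb1 D γ := by
    by_contra! hh
    nlinarith [mul_pos g2 p1]
  have g1' : emb1 D β < emb1 D γ := by
    by_contra! hh
    rcases hh.lt_or_eq with hlt | heq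
    · refine hind ⟨γ, β - γ, ⟨g1, g2⟩, ⟨?_, ?_⟩, by simp⟩
      · rw [emb1_sub]; linarith
      · rw [emb2_sub]; linarith
    · -- conjugate argument: `emb1 (γ - β) = 0`; use the norm being an integer
      have hn : Nm D (γ - β) = 0 := by
        unfold Nm; rw [emb1_sub, heq, sub_self, zero_mul]
      have hz : γ - β = 0 := by
        have hc : emb2 D (conjOK D (γ - β)) = emb1 D (γ - β) := by
          unfold emb2 emb1 conjOK omegaD omegaD'
          split_ifs <;> push_cast <;> ring
        rw [emb1_sub, heq, sub_self] at hc
        have h0 := emb2_eq_zero D hD hsq _ hc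
        have ha := congrArg Prod.fst h0
        have hb := congrArg Prod.snd h0
        simp only [conjOK, Prod.fst_zero, Prod.snd_zero] at ha hb
        have hb' : (γ - β).2 = 0 := by omega
        rw [hb'] at ha
        exact Prod.ext (by simpa using ha) hb'
      have := sub_eq_zero.1 hz
      rw [this] at g2'
      exact lt_irrefl _ g2'
  exact ⟨γ, ⟨g1, g2⟩, hdet, g1', g2'⟩

/-- Every totally positive element lies in the cone of two adjacent indecomposables. -/
lemma exists_cone (D : ℕ) (hD : 2 ≤ D) (hsq : Squarefree D) (α : OK) (hα : TotPos D α) :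
    ∃ (β γ : OK) (a b : ℕ), Indec D β ∧ Indec D γ ∧ β.1 * γ.2 - β.2 * γ.1 = 1 ∧
      emb1 D β < emb1 D γ ∧ emb2 D γ < emb2 D β ∧ α = a • β + b • γ := by
  have hs := two_le_s D hD
  obtain ⟨a1, a2⟩ := hα
  let S : Set OK := {x | TotPos D x ∧ emb2 D x ≤ emb2 D α ∧
    emb2 D α * emb1 D x ≤ emb1 D α * emb2 D x}
  have hSfin : S.Finite := by
    apply (finite_box D hD (max (emb1 D α) (emb2 D α))).subset
    rintro x ⟨hx, h2, h3⟩
    refine ⟨hx, le_max_of_le_left ?_, le_max_of_le_right h2⟩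
    by_contra! hh
    nlinarith [hx.1, hx.2]
  have hSne : S.Nonempty := ⟨α, ⟨a1, a2⟩, le_rfl, by rw [mul_comm]⟩
  obtain ⟨β, hβS, hmin⟩ := Set.exists_min_image S (emb2 D) hSfin hSne
  obtain ⟨hβ, hβ2, hβ3⟩ := hβS
  have hmin' : ∀ x, TotPos D x → emb2 D x < emb2 D β →
      emb1 D α * emb2 D x < emb2 D α * emb1 D x := by
    intro x hx hlt
    by_contra! hh
    have := hmin x ⟨hx, by linarith, hh⟩
    linarith
  have hβi : Indec D β := by
    refine ⟨hβ, ?_⟩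
    rintro ⟨b, c, hb, hc, hbc⟩
    have e1 : emb1 D β = emb1 D b + emb1 D c := by rw [hbc, emb1_add]
    have e2 : emb2 D β = emb2 D b + emb2 D c := by rw [hbc, emb2_add]
    have h1 := hmin' b hb (by linarith [hc.2])
    have h2 := hmin' c hc (by linarith [hb.2])
    rw [e1, e2] at hβ3
    linarith
  obtain ⟨γ, hγ, hdet, h1, h2⟩ := exists_neighbour D hD hsq β hβi
  have hγi := adj_indec D hD β γ hβ hγ hdet h1 h2
  have h3 := hmin' γ hγ h2
  have d1 := det_id D α γ
  have d2 := det_id D β α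
  set i : ℤ := α.1 * γ.2 - α.2 * γ.1 with hi
  set j : ℤ := β.1 * α.2 - β.2 * α.1 with hj
  have hi0 : 0 ≤ i := by
    have : (0 : ℝ) ≤ i := by
      by_contra! hh
      nlinarith
    exact_mod_cast this
  have hj0 : 0 ≤ j := by
    by_contra! hh
    have : (j : ℝ) < 0 := by exact_mod_cast hh
    nlinarith
  have hα' : α = i • β + j • γ := by
    ext
    · simp only [Prod.fst_add, Prod.smul_fst, smul_eq_mul, hj, hi]
      linear_combination (-α.1) * hdet
    · simp only [Prod.snd_add, Prod.smul_snd, smul_eq_mul, hj, hi]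
      linear_combination (-α.2) * hdet
  obtain ⟨a, ha⟩ := Int.eq_ofNat_of_zero_le hi0
  obtain ⟨b, hb⟩ := Int.eq_ofNat_of_zero_le hj0
  refine ⟨β, γ, a, b, hβi, hγi, hdet, h1, h2, ?_⟩
  rw [ha, hb] at hα'
  simpa using hα'

/-- Bound on the first coefficient. -/
lemma coeff1 (D : ℕ) (hD : 2 ≤ D) (m : ℕ) (hm : 1 ≤ m) (a b : ℕ) (α β γ : OK) (hβ : Indec D β)
    (hγ : Indec D γ) (h1 : emb1 D β < emb1 D γ) (h2 : emb2 D γ < emb2 D β)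
    (hα : α = a • β + b • γ) (h : pKI D α ≤ m) :
    (a : ℝ) * emb1 D β ≤ m * (emb1 D γ + emb1 D β) := by
  have p1 := hβ.1.1
  have p2 := hβ.1.2
  have q1 := hγ.1.1
  have q2 := hγ.1.2
  let n : ℕ := ⌊emb1 D γ / emb1 D β⌋₊
  have hn1 : (n : ℝ) * emb1 D β ≤ emb1 D γ := by
    rw [← le_div_iff₀ p1]; exact Nat.floor_le (by positivity)
  have hn2 : emb1 D γ < (n + 1) * emb1 D β := by
    rw [← div_lt_iff₀ p1]; exact Nat.lt_floor_add_one _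
  have hn0 : 1 ≤ n := by
    rw [Nat.one_le_floor_iff, le_div_iff₀ p1]; linarith
  have hn0' : (1 : ℝ) ≤ n := by exact_mod_cast hn0
  let δ : OK := (n + 1) • β - γ
  have d1 : emb1 D δ = (n + 1) * emb1 D β - emb1 D γ := by
    rw [emb1_sub, emb1_nsmul]; push_cast; ring
  have d2 : emb2 D δ = (n + 1) * emb2 D β - emb2 D γ := by
    rw [emb2_sub, emb2_nsmul]; push_cast; ring
  have d2' : emb2 D β < emb2 D δ := by rw [d2]; nlinarith
  have key := many_parts D hD m a b (n + 1) α β γ δ hβ hγ.1 ⟨by rw [d1]; linarith, by linarith⟩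
    (fun hh => by have := hh.2; rw [emb2_sub] at this; linarith)
    (fun hh => by rw [hh] at h2; exact lt_irrefl _ h2)
    (fun hh => by have := hh.1; rw [emb1_sub, d1] at this; linarith)
    (fun hh => by rw [hh] at d2'; exact lt_irrefl _ d2')
    (by omega) (by simp [δ]) hα h
  have key' : (a : ℝ) ≤ m * (n + 1) := by exact_mod_cast key.le
  have hm0 : (0 : ℝ) ≤ m := Nat.cast_nonneg m
  calc (a : ℝ) * emb1 D β ≤ m * (n + 1) * emb1 D β := by gcongr
    _ = m * (n * emb1 D β + emb1 D β) := by ring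
    _ ≤ _ := by gcongr

/-- Bound on the second coefficient. -/
lemma coeff2 (D : ℕ) (hD : 2 ≤ D) (m : ℕ) (hm : 1 ≤ m) (a b : ℕ) (α β γ : OK) (hβ : Indec D β)
    (hγ : Indec D γ) (h1 : emb2 D β < emb2 D γ) (h2 : emb1 D γ < emb1 D β)
    (hα : α = a • β + b • γ) (h : pKI D α ≤ m) :
    (a : ℝ) * emb2 D β ≤ m * (emb2 D γ + emb2 D β) := by
  have p1 := hβ.1.2
  have p2 := hβ.1.1
  have q1 := hγ.1.2
  have q2 := hγ.1.1
  let n : ℕ := ⌊emb2 D γ / emb2 D β⌋₊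
  have hn1 : (n : ℝ) * emb2 D β ≤ emb2 D γ := by
    rw [← le_div_iff₀ p1]; exact Nat.floor_le (by positivity)
  have hn2 : emb2 D γ < (n + 1) * emb2 D β := by
    rw [← div_lt_iff₀ p1]; exact Nat.lt_floor_add_one _
  have hn0 : 1 ≤ n := by
    rw [Nat.one_le_floor_iff, le_div_iff₀ p1]; linarith
  have hn0' : (1 : ℝ) ≤ n := by exact_mod_cast hn0
  let δ : OK := (n + 1) • β - γ
  have d1 : emb2 D δ = (n + 1) * emb2 D β - emb2 D γ := by
    rw [emb2_sub, emb2_nsmul]; push_cast; ring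
  have d2 : emb1 D δ = (n + 1) * emb1 D β - emb1 D γ := by
    rw [emb1_sub, emb1_nsmul]; push_cast; ring
  have d2' : emb1 D β < emb1 D δ := by rw [d2]; nlinarith
  have key := many_parts D hD m a b (n + 1) α β γ δ hβ hγ.1 ⟨by linarith, by rw [d1]; linarith⟩
    (fun hh => by have := hh.1; rw [emb1_sub] at this; linarith)
    (fun hh => by rw [hh] at h2; exact lt_irrefl _ h2)
    (fun hh => by have := hh.2; rw [emb2_sub, d1] at this; linarith)
    (fun hh => by rw [hh] at d2'; exact lt_irrefl _ d2')
    (by omega) (by simp [δ]) hα h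
  have key' : (a : ℝ) ≤ m * (n + 1) := by exact_mod_cast key.le
  have hm0 : (0 : ℝ) ≤ m := Nat.cast_nonneg m
  calc (a : ℝ) * emb2 D β ≤ m * (n + 1) * emb2 D β := by gcongr
    _ = m * (n * emb2 D β + emb2 D β) := by ring
    _ ≤ _ := by gcongr

/-- `a p ≤ m (2p + s)` implies `a² p ≤ m² (s+2)²` when `1 ≤ p ≤ s²/4`. -/
lemma sq_bound (a m p s : ℝ) (ha : 0 ≤ a) (hp1 : 1 ≤ p) (hp2 : 4 * p ≤ s ^ 2)
    (h : a * p ≤ m * (2 * p + s)) : a ^ 2 * p ≤ m ^ 2 * (s + 2) ^ 2 := by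
  have h1 : (a * p) ^ 2 ≤ (m * (2 * p + s)) ^ 2 := pow_le_pow_left₀ (by positivity) h 2
  have h2 : (2 * p + s) ^ 2 ≤ p * (s + 2) ^ 2 := by nlinarith
  have h3 : m ^ 2 * (2 * p + s) ^ 2 ≤ m ^ 2 * (p * (s + 2) ^ 2) := by gcongr
  have h4 : p * (a ^ 2 * p) ≤ p * (m ^ 2 * (s + 2) ^ 2) := by nlinarith
  exact le_of_mul_le_mul_left h4 (by linarith)

/-- The final estimate. -/
lemma final_bound (a b p q T s M : ℝ) (ha : 0 ≤ a) (hb : 0 ≤ b) (hp : 1 ≤ p) (hq : 1 ≤ q)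
    (hs : 0 ≤ s) (hT : T ^ 2 = s ^ 2 + 4 * (p * q)) (hA : a ^ 2 * p ≤ M) (hB : b ^ 2 * q ≤ M) :
    a ^ 2 * p + a * b * T + b ^ 2 * q ≤ M * (s + 4) := by
  have hA0 : a ^ 2 ≤ a ^ 2 * p := le_mul_of_one_le_right (by positivity) hp
  have hB0 : b ^ 2 ≤ b ^ 2 * q := le_mul_of_one_le_right (by positivity) hq
  have hM : 0 ≤ M := (sq_nonneg a).trans (hA0.trans hA)
  have h1 : a ^ 2 * b ^ 2 ≤ M * M := by
    apply mul_le_mul (hA0.trans hA) (hB0.trans hB) (by positivity) hM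
  have h2 : (a ^ 2 * p) * (b ^ 2 * q) ≤ M * M := by
    apply mul_le_mul hA hB (by positivity) hM
  have h3 : (a * b * T) ^ 2 ≤ (M * (s + 2)) ^ 2 := by
    have e : (a * b * T) ^ 2 = s ^ 2 * (a ^ 2 * b ^ 2) + 4 * ((a ^ 2 * p) * (b ^ 2 * q)) := by
      rw [mul_pow, hT]; ring
    rw [e]
    have h4 : s ^ 2 * (a ^ 2 * b ^ 2) ≤ s ^ 2 * (M * M) := by gcongr
    nlinarith [mul_nonneg hs (mul_nonneg hM hM)]
  have h5 : a * b * T ≤ M * (s + 2) := abs_le_of_sq_le_sq' h3 (by positivity) |>.2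
  linarith

/-- Main theorem: norm bound for elements with at most `m`
representations as sums of indecomposables. -/
theorem stmt6 (D : ℕ) (hD : 2 ≤ D) (hsq : Squarefree D)
    (m : ℕ) (hm : 1 ≤ m) (α : OK) (hα : TotPos D α) (h : pKI D α ≤ m) :
    Nm D α < (m : ℝ) ^ 2 * (2 * m + 1) * (2 * m + 3) *
      Real.sqrt (disc D) * (Real.sqrt (disc D) + 2) ^ 2 := by
  have hs := two_le_s D hD
  obtain ⟨β, γ, a, b, hβ, hγ, hdet, h1, h2, hαe⟩ := exists_cone D hD hsq α hα
  have c1 := coeff1 D hD m hm a b α β γ hβ hγ h1 h2 hαe h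
  have c2 := coeff2 D hD m hm b a α γ β hγ hβ h2 h1 (by rw [hαe, add_comm]) h
  have hid := det_id D β γ
  rw [hdet] at hid
  push_cast at hid
  have p1 := hβ.1.1
  have p2 := hβ.1.2
  have q1 := hγ.1.1
  have q2 := hγ.1.2
  have hp := one_le_of_int (norm_int D β) (mul_pos p1 p2)
  have hq := one_le_of_int (norm_int D γ) (mul_pos q1 q2)
  have hn : 1 ≤ -Nm D (γ - β) := by
    apply one_le_of_int
    · obtain ⟨z, hz⟩ := norm_int D (γ - β)
      exact ⟨-z, by rw [hz]; push_cast; ring⟩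
    · unfold Nm
      rw [emb1_sub, emb2_sub]
      nlinarith
  have hN : Nm D α = (a * emb1 D β + b * emb1 D γ) * (a * emb2 D β + b * emb2 D γ) := by
    unfold Nm
    rw [hαe, emb1_add, emb2_add, emb1_nsmul, emb1_nsmul, emb2_nsmul, emb2_nsmul]
  unfold Nm at hp hq hn
  rw [emb1_sub, emb2_sub] at hn
  rw [hN]
  clear hN
  generalize Real.sqrt (disc D) = s at *
  generalize emb1 D β = x1 at *
  generalize emb2 D β = x2 at *
  generalize emb1 D γ = y1 at *
  generalize emb2 D γ = y2 at *
  have hs2 : s = y1 * x2 - y2 * x1 := by linarith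
  have hm1 : (1 : ℝ) ≤ m := by exact_mod_cast hm
  have P4 : 4 * (x1 * x2) ≤ s ^ 2 := by
    have e : s ^ 2 = (y1 * x2 + y2 * x1 - 2 * (x1 * x2)) ^ 2
        + 4 * (x1 * x2) * (-((y1 - x1) * (y2 - x2))) := by rw [hs2]; ring
    rw [e]
    nlinarith [sq_nonneg (y1 * x2 + y2 * x1 - 2 * (x1 * x2))]
  have Q4 : 4 * (y1 * y2) ≤ s ^ 2 := by
    have e : s ^ 2 = (y1 * x2 + y2 * x1 - 2 * (y1 * y2)) ^ 2
        + 4 * (y1 * y2) * (-((y1 - x1) * (y2 - x2))) := by rw [hs2]; ring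
    rw [e]
    nlinarith [sq_nonneg (y1 * x2 + y2 * x1 - 2 * (y1 * y2))]
  have A : (a : ℝ) ^ 2 * (x1 * x2) ≤ m ^ 2 * (s + 2) ^ 2 := by
    apply sq_bound _ _ _ _ (Nat.cast_nonneg a) hp P4
    calc (a : ℝ) * (x1 * x2) = a * x1 * x2 := by ring
      _ ≤ m * (y1 + x1) * x2 := by gcongr
      _ = m * (y1 * x2 + x1 * x2) := by ring
      _ ≤ m * (2 * (x1 * x2) + s) := by
        apply mul_le_mul_of_nonneg_left _ (by linarith)
        nlinarith
  have B : (b : ℝ) ^ 2 * (y1 * y2) ≤ m ^ 2 * (s + 2) ^ 2 := by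
    apply sq_bound _ _ _ _ (Nat.cast_nonneg b) hq Q4
    calc (b : ℝ) * (y1 * y2) = b * y2 * y1 := by ring
      _ ≤ m * (x2 + y2) * y1 := by gcongr
      _ = m * (y1 * x2 + y1 * y2) := by ring
      _ ≤ m * (2 * (y1 * y2) + s) := by
        apply mul_le_mul_of_nonneg_left _ (by linarith)
        nlinarith
  have F := final_bound a b (x1 * x2) (y1 * y2) (y1 * x2 + y2 * x1) s _ (Nat.cast_nonneg a)
    (Nat.cast_nonneg b) hp hq (by linarith) (by rw [hs2]; ring) A B
  have G : s + 4 < (2 * m + 1) * (2 * m + 3) * s := by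
    have : (15 : ℝ) ≤ (2 * m + 1) * (2 * m + 3) := by nlinarith
    nlinarith
  have hM : (0 : ℝ) < m ^ 2 * (s + 2) ^ 2 := by positivity
  calc _ = (a : ℝ) ^ 2 * (x1 * x2) + a * b * (y1 * x2 + y2 * x1) + b ^ 2 * (y1 * y2) := by ring
    _ ≤ m ^ 2 * (s + 2) ^ 2 * (s + 4) := F
    _ < m ^ 2 * (s + 2) ^ 2 * ((2 * m + 1) * (2 * m + 3) * s) := by gcongr
    _ = _ := by ring
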